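/- A finite group G satisfies i(G) = c(G) - 2 if and only if G is isomorphic to one of: Z/2 × Z/4, Z/2 × D8, Z/8, D16, Z/p^2, D_{2p^2}, Z/2p, or D_{4p}, where p is an odd prime. -/

import Mathlib

noncomputable def numInv (G : Type*) [Group G] : ℕ := Nat.card {x : G // x ^ 2 = 1}

noncomputable def numCyc (G : Type*) [Group G] : ℕ := Nat.card {H : Subgroup G // IsCyclic H}

open Subgroup in
/-- The number of cyclic subgroups of order greater than two. -/
noncomputable def numBigCyc (G : Type*) [Group G] : ℕ :=
  (zpowers '' {x : G | x ^ 2 ≠ 1}).ncard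

namespace BigCyc

open Subgroup Function

lemma sq_eq_one_iff_of_zpowers_eq {G : Type*} [Group G] {x y : G} (h : zpowers x = zpowers y) :
    x ^ 2 = 1 ↔ y ^ 2 = 1 := by
  rw [← orderOf_dvd_iff_pow_eq_one, ← orderOf_dvd_iff_pow_eq_one, ← Nat.card_zpowers,
    ← Nat.card_zpowers, h]

lemma eq_one_or_eq_of_mem_zpowers {G : Type*} [Group G] {x y : G} (hy : y ^ 2 = 1)
    (hx : x ∈ zpowers y) : x = 1 ∨ x = y := by
  obtain ⟨k, rfl⟩ := hx
  have hy' : y ^ (2 : ℤ) = 1 := mod_cast hy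
  obtain ⟨j, rfl | rfl⟩ := Int.even_or_odd' k
  · left; simp [zpow_mul, hy']
  · right; simp [zpow_add, zpow_mul, hy']

lemma eq_of_zpowers_eq_of_sq_eq_one {G : Type*} [Group G] {x y : G} (hx : x ^ 2 = 1)
    (hy : y ^ 2 = 1) (h : zpowers x = zpowers y) : x = y := by
  have h1 := eq_one_or_eq_of_mem_zpowers hy (h ▸ mem_zpowers x)
  have h2 := eq_one_or_eq_of_mem_zpowers hx (h ▸ mem_zpowers y)
  grind

lemma numCyc_eq (G : Type*) [Group G] [Finite G] : numCyc G = numInv G + numBigCyc G := by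
  have hu : {H : Subgroup G | IsCyclic H} =
      zpowers '' {x : G | x ^ 2 = 1} ∪ zpowers '' {x : G | x ^ 2 ≠ 1} := by
    ext H
    rw [← Set.image_union]
    simp only [Set.mem_ofPred_eq, Set.mem_image, Set.mem_union, ne_eq, em, true_and]
    exact H.isCyclic_iff_exists_zpowers_eq_top
  have hd : Disjoint (zpowers '' {x : G | x ^ 2 = 1}) (zpowers '' {x : G | x ^ 2 ≠ 1}) := by
    rw [Set.disjoint_left]
    rintro _ ⟨x, hx, rfl⟩ ⟨y, hy, h⟩
    exact hy ((sq_eq_one_iff_of_zpowers_eq h).2 hx)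
  have hi : (zpowers '' {x : G | x ^ 2 = 1}).ncard = numInv G :=
    Set.InjOn.ncard_image fun x hx y hy h ↦ eq_of_zpowers_eq_of_sq_eq_one hx hy h
  rw [← hi, numBigCyc, ← Set.ncard_union_eq hd, ← hu]
  rfl

lemma numInv_eq_iff (G : Type*) [Group G] [Finite G] :
    numInv G = numCyc G - 2 ↔ numBigCyc G = 2 := by
  have : 0 < numInv G := Nat.card_pos_iff.2 ⟨⟨⟨1, one_pow 2⟩⟩, inferInstance⟩
  rw [numCyc_eq]
  omega

lemma numBigCyc_eq_two_iff (G : Type*) [Group G] :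
    numBigCyc G = 2 ↔ ∃ a b : G, a ^ 2 ≠ 1 ∧ b ^ 2 ≠ 1 ∧ zpowers a ≠ zpowers b ∧
      ∀ x : G, x ^ 2 ≠ 1 → zpowers x = zpowers a ∨ zpowers x = zpowers b := by
  rw [numBigCyc, Set.ncard_eq_two]
  constructor
  · rintro ⟨H, K, hne, h⟩
    obtain ⟨a, ha, rfl⟩ : H ∈ zpowers '' {x : G | x ^ 2 ≠ 1} := by simp [h]
    obtain ⟨b, hb, rfl⟩ : K ∈ zpowers '' {x : G | x ^ 2 ≠ 1} := by simp [h]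
    refine ⟨a, b, ha, hb, hne, fun x hx ↦ ?_⟩
    have : zpowers x ∈ zpowers '' {x : G | x ^ 2 ≠ 1} := ⟨x, hx, rfl⟩
    simpa [h] using this
  · rintro ⟨a, b, ha, hb, hne, h⟩
    refine ⟨zpowers a, zpowers b, hne, Set.Subset.antisymm ?_ ?_⟩
    · rintro _ ⟨x, hx, rfl⟩
      exact h x hx
    · rintro _ (rfl | rfl)
      exacts [⟨a, ha, rfl⟩, ⟨b, hb, rfl⟩]

/-- An embedding outside whose range every element squares to one. -/
structure IsInvolutiveOutside {A G : Type*} [Group A] [Group G] (f : A →* G) : Prop where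
  injective : Injective f
  sq_eq_one : ∀ g ∉ f.range, g ^ 2 = 1

lemma _root_.MulEquiv.isInvolutiveOutside {A G : Type*} [Group A] [Group G] (e : A ≃* G) :
    IsInvolutiveOutside e.toMonoidHom :=
  ⟨e.injective, fun g hg ↦ (hg ⟨e.symm g, by simp⟩).elim⟩

namespace IsInvolutiveOutside

variable {A G G' : Type*} [Group G] [Group G']

lemma comp [Group A] {f : A →* G} (hf : IsInvolutiveOutside f) (e : G ≃* G') :
    IsInvolutiveOutside (e.toMonoidHom.comp f) where
  injective := e.injective.comp hf.injective
  sq_eq_one g hg := by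
    rw [← e.apply_symm_apply g, ← map_pow, hf.sq_eq_one, map_one]
    rintro ⟨a, ha⟩
    exact hg ⟨a, by simp [ha]⟩

lemma numBigCyc_eq [Group A] {f : A →* G} (hf : IsInvolutiveOutside f) :
    numBigCyc G = numBigCyc A := by
  have : zpowers '' {x : G | x ^ 2 ≠ 1} =
      Subgroup.map f '' (zpowers '' {x : A | x ^ 2 ≠ 1}) := by
    ext H
    simp only [Set.mem_image, Set.mem_ofPred_eq, exists_exists_and_eq_and, MonoidHom.map_zpowers]
    constructor
    · rintro ⟨x, hx, rfl⟩
      obtain ⟨a, rfl⟩ : x ∈ f.range := by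
        by_contra h
        exact hx (hf.sq_eq_one x h)
      exact ⟨a, fun h ↦ hx (by rw [← map_pow, h, map_one]), rfl⟩
    · rintro ⟨a, ha, rfl⟩
      exact ⟨f a, fun h ↦ ha (hf.injective (by rw [map_pow, h, map_one])), rfl⟩
  rw [numBigCyc, this, Set.ncard_image_of_injective _ (Subgroup.map_injective hf.injective),
    numBigCyc]

variable [CommGroup A] {f : A →* G}

lemma mul_eq (hf : IsInvolutiveOutside f) {x : G} (hx : x ∉ f.range) (a : A) :
    x * f a = f a⁻¹ * x := by
  have h1 := hf.sq_eq_one x hx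
  have h2 : (x * f a) ^ 2 = 1 :=
    hf.sq_eq_one _ fun h ↦ hx (by simpa using mul_mem h (inv_mem (⟨a, rfl⟩ : f a ∈ f.range)))
  rw [pow_two] at h1 h2
  have h3 := eq_inv_of_mul_eq_one_left h2
  rw [h3, mul_inv_rev, map_inv, inv_eq_of_mul_eq_one_left h1]

lemma mul_mem_range (hf : IsInvolutiveOutside f) {c : A} (hc : c ^ 2 ≠ 1) {x y : G}
    (hx : x ∉ f.range) (hy : y ∉ f.range) : x * y ∈ f.range := by
  by_contra hxy
  have h := hf.mul_eq hxy c
  rw [mul_assoc, hf.mul_eq hy, ← mul_assoc, hf.mul_eq hx, inv_inv, mul_assoc,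
    mul_left_inj] at h
  apply hc
  rw [pow_two]
  exact mul_eq_one_iff_eq_inv.2 (hf.injective h)

lemma bijective_elim (hf : IsInvolutiveOutside f) {c : A} (hc : c ^ 2 ≠ 1) {x : G}
    (hx : x ∉ f.range) : Bijective (Sum.elim f fun a ↦ f a * x) := by
  constructor
  · refine hf.injective.sumElim (fun a b h ↦ hf.injective (mul_right_cancel h)) fun a b h ↦ hx ?_
    exact ⟨b⁻¹ * a, by simp [h]⟩
  · intro g
    by_cases hg : g ∈ f.range
    · obtain ⟨a, rfl⟩ := hg
      exact ⟨.inl a, rfl⟩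
    · obtain ⟨a, ha⟩ := hf.mul_mem_range hc hg hx
      refine ⟨.inr a, ?_⟩
      have := hf.sq_eq_one x hx
      simp [ha, mul_assoc, ← pow_two, this]

lemma nonempty_mulEquiv (hf : IsInvolutiveOutside f) {f' : A →* G'}
    (hf' : IsInvolutiveOutside f') {c : A} (hc : c ^ 2 ≠ 1) (hs : ¬ Surjective f)
    (hs' : ¬ Surjective f') : Nonempty (G ≃* G') := by
  obtain ⟨x, hx⟩ : ∃ x, x ∉ f.range := by simpa [Surjective] using hs
  obtain ⟨x', hx'⟩ : ∃ x, x ∉ f'.range := by simpa [Surjective] using hs'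
  let e := Equiv.ofBijective _ (hf.bijective_elim hc hx)
  let e' := Equiv.ofBijective _ (hf'.bijective_elim hc hx')
  have hl (a) : e (.inl a) = f a := rfl
  have hr (a) : e (.inr a) = f a * x := rfl
  have hl' (a) : e' (.inl a) = f' a := rfl
  have hr' (a) : e' (.inr a) = f' a * x' := rfl
  let m : A ⊕ A → A ⊕ A → A ⊕ A := fun u v ↦ match u, v with
    | .inl a, .inl b => .inl (a * b)
    | .inl a, .inr b => .inr (a * b)
    | .inr a, .inl b => .inr (a * b⁻¹)
    | .inr a, .inr b => .inl (a * b⁻¹)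
  have hm (u v) : e (m u v) = e u * e v := by
    have hxx : x * x = 1 := by rw [← pow_two, hf.sq_eq_one x hx]
    rcases u with a | a <;> rcases v with b | b <;>
      simp only [m, hl, hr, map_mul, mul_assoc]
    · rw [hf.mul_eq hx]
    · rw [← mul_assoc x, hf.mul_eq hx, mul_assoc, hxx, mul_one]
  have hm' (u v) : e' (m u v) = e' u * e' v := by
    have hxx : x' * x' = 1 := by rw [← pow_two, hf'.sq_eq_one x' hx']
    rcases u with a | a <;> rcases v with b | b <;>
      simp only [m, hl', hr', map_mul, mul_assoc]
    · rw [hf'.mul_eq hx']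
    · rw [← mul_assoc x', hf'.mul_eq hx', mul_assoc, hxx, mul_one]
  refine ⟨MulEquiv.mk' (e.symm.trans e') fun g h ↦ ?_⟩
  obtain ⟨u, rfl⟩ := e.surjective g
  obtain ⟨v, rfl⟩ := e.surjective h
  simp [← hm, hm']

lemma nonempty_mulEquiv_or (hf : IsInvolutiveOutside f) {f' : A →* G'}
    (hf' : IsInvolutiveOutside f') {c : A} (hc : c ^ 2 ≠ 1) (hs' : ¬ Surjective f') :
    Nonempty (G ≃* A) ∨ Nonempty (G ≃* G') := by
  by_cases hs : Surjective f
  · exact .inl ⟨(MulEquiv.ofBijective f ⟨hf.injective, hs⟩).symm⟩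
  · exact .inr (hf.nonempty_mulEquiv hf' hc hs hs')

end IsInvolutiveOutside

/-- The rotations of a dihedral group. -/
def rotation (n : ℕ) : Multiplicative (ZMod n) →* DihedralGroup n where
  toFun i := .r i.toAdd
  map_one' := rfl
  map_mul' _ _ := rfl

lemma isInvolutiveOutside_rotation (n : ℕ) : IsInvolutiveOutside (rotation n) where
  injective i j h := DihedralGroup.r.inj h
  sq_eq_one g hg := by
    rcases g with i | i
    · exact (hg ⟨.ofAdd i, rfl⟩).elim
    · rw [pow_two, DihedralGroup.sr_mul_self]

lemma not_surjective_rotation (n : ℕ) : ¬ Surjective (rotation n) := fun h ↦ by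
  obtain ⟨i, hi⟩ := h (.sr 0)
  simp [rotation] at hi

lemma isInvolutiveOutside_prodMap_rotation : IsInvolutiveOutside
    ((MonoidHom.id (Multiplicative (ZMod 2))).prodMap (rotation 4)) where
  injective := injective_id.prodMap (isInvolutiveOutside_rotation 4).injective
  sq_eq_one := by
    rintro ⟨i, g⟩ h
    refine Prod.ext ?_ ((isInvolutiveOutside_rotation 4).sq_eq_one g ?_)
    · exact (by decide : ∀ i : Multiplicative (ZMod 2), i ^ 2 = 1) i
    · rintro ⟨j, hj⟩
      exact h ⟨(i, j), Prod.ext rfl hj⟩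

lemma not_surjective_prodMap_rotation :
    ¬ Surjective ((MonoidHom.id (Multiplicative (ZMod 2))).prodMap (rotation 4)) := fun h ↦ by
  obtain ⟨⟨i, j⟩, h⟩ := h (1, .sr 0)
  simp [rotation] at h

lemma zpowers_eq_of_orderOf_eq {A : Type*} [CommGroup A] [IsCyclic A] [Finite A] {x y : A}
    (h : orderOf x = orderOf y) : zpowers x = zpowers y := by
  have key (z : A) : zpowers z = (powMonoidHom (orderOf z) : A →* A).ker := by
    refine Subgroup.eq_of_le_of_card_ge ?_ ?_
    · rw [zpowers_le]
      exact pow_orderOf_eq_one z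
    · rw [IsCyclic.card_powMonoidHom_ker, Nat.card_zpowers]
      exact Nat.gcd_le_right _ (orderOf_pos z)
  rw [key x, key y, h]

lemma sq_ne_one_iff {G : Type*} [Group G] [Finite G] (x : G) : x ^ 2 ≠ 1 ↔ 2 < orderOf x := by
  rw [ne_eq, ← orderOf_dvd_iff_pow_eq_one, Nat.dvd_prime Nat.prime_two]
  have := orderOf_pos x
  omega

lemma numBigCyc_zmod {n q : ℕ} (hq : 2 < q) (hqn : q < n) (hdvd : q ∣ n)
    (h : ∀ d, d ∣ n → 2 < d → d = q ∨ d = n) : numBigCyc (Multiplicative (ZMod n)) = 2 := by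
  have : NeZero n := ⟨by omega⟩
  have ha : orderOf (Multiplicative.ofAdd (1 : ZMod n)) = n := by
    rw [orderOf_ofAdd_eq_addOrderOf, ZMod.addOrderOf_one]
  obtain ⟨k, hk⟩ := hdvd
  have hb : orderOf (Multiplicative.ofAdd (1 : ZMod n) ^ k) = q := by
    rw [orderOf_pow_of_dvd (by rintro rfl; omega) (by rw [ha, hk]; exact dvd_mul_left k q), ha]
    exact Nat.div_eq_of_eq_mul_left (by rcases k with _ | k <;> omega) hk
  rw [numBigCyc_eq_two_iff]
  refine ⟨_, _, (sq_ne_one_iff _).2 (hb ▸ hq), (sq_ne_one_iff _).2 (ha ▸ hq.trans hqn),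
    fun h ↦ ?_, fun x hx ↦ ?_⟩
  · have := congrArg (fun H : Subgroup _ ↦ Nat.card H) h
    simp only [Nat.card_zpowers, ha, hb] at this
    omega
  · rw [sq_ne_one_iff] at hx
    have hxn : orderOf x ∣ n := by
      simpa using orderOf_dvd_natCard x
    exact (h _ hxn hx).imp (fun h ↦ zpowers_eq_of_orderOf_eq (h.trans hb.symm))
      fun h ↦ zpowers_eq_of_orderOf_eq (h.trans ha.symm)

lemma numBigCyc_zmod_eight : numBigCyc (Multiplicative (ZMod 8)) = 2 :=
  numBigCyc_zmod (q := 4) (by norm_num) (by norm_num) (by norm_num) fun d hd h ↦ by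
    have := Nat.le_of_dvd (by norm_num) hd
    interval_cases d <;> omega

lemma numBigCyc_zmod_prime_sq {p : ℕ} (hp : p.Prime) (ho : Odd p) :
    numBigCyc (Multiplicative (ZMod (p ^ 2))) = 2 := by
  have h2 : 2 < p := hp.two_le.lt_of_ne (by rintro rfl; exact absurd ho (by decide))
  refine numBigCyc_zmod (q := p) h2 (by nlinarith) (dvd_pow_self p two_ne_zero) fun d hd h ↦ ?_
  obtain ⟨k, hk, rfl⟩ := (Nat.dvd_prime_pow hp).1 hd
  interval_cases k <;> simp_all

lemma numBigCyc_zmod_two_mul_prime {p : ℕ} (hp : p.Prime) (ho : Odd p) :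
    numBigCyc (Multiplicative (ZMod (2 * p))) = 2 := by
  have h2 : 2 < p := hp.two_le.lt_of_ne (by rintro rfl; exact absurd ho (by decide))
  refine numBigCyc_zmod (q := p) h2 (by omega) (dvd_mul_left p 2) fun d hd h ↦ ?_
  obtain ⟨u, v, hu, hv, rfl⟩ := exists_dvd_and_dvd_of_dvd_mul hd
  rcases (Nat.dvd_prime Nat.prime_two).1 hu with rfl | rfl <;>
    rcases (Nat.dvd_prime hp).1 hv with rfl | rfl <;> simp_all

lemma numBigCyc_zmod_two_prod_zmod_four :
    numBigCyc (Multiplicative (ZMod 2) × Multiplicative (ZMod 4)) = 2 := by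
  rw [numBigCyc_eq_two_iff]
  refine ⟨(.ofAdd 0, .ofAdd 1), (.ofAdd 1, .ofAdd 1), by decide, by decide, fun h ↦ ?_,
    fun x hx ↦ ?_⟩
  · obtain ⟨k, hk⟩ := mem_zpowers_iff.1 (h ▸ mem_zpowers _ :
      ((.ofAdd 1, .ofAdd 1) : Multiplicative (ZMod 2) × Multiplicative (ZMod 4)) ∈
        zpowers (.ofAdd 0, .ofAdd 1))
    have := congrArg Prod.fst hk
    rw [Prod.pow_fst, ofAdd_zero, one_zpow] at this
    exact absurd this (by decide)
  · have key : ∀ x : Multiplicative (ZMod 2) × Multiplicative (ZMod 4), x ^ 2 ≠ 1 →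
        x = (.ofAdd 0, .ofAdd 1) ∨ x = (.ofAdd 0, .ofAdd 1)⁻¹ ∨
        x = (.ofAdd 1, .ofAdd 1) ∨ x = (.ofAdd 1, .ofAdd 1)⁻¹ := by decide
    rcases key x hx with rfl | rfl | rfl | rfl <;> simp only [zpowers_inv, true_or, or_true]

lemma eight_or_prime_sq_or_two_mul_prime {n q : ℕ} (hq : 2 < q) (hqn : q < n) (hdvd : q ∣ n)
    (h : ∀ d, d ∣ n → 2 < d → d = q ∨ d = n) :
    n = 8 ∨ ∃ p : ℕ, p.Prime ∧ Odd p ∧ (n = p ^ 2 ∨ n = 2 * p) := by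
  rcases Nat.eq_two_pow_or_exists_odd_prime_and_dvd n with ⟨k, rfl⟩ | ⟨p, hp, hpn, ho⟩
  · left
    have hk : 3 ≤ k := by
      by_contra! hk
      interval_cases k
      · omega
      · omega
      · obtain rfl : q = 3 := by omega
        omega
    have h4 := h 4 (pow_dvd_pow 2 (by omega : 2 ≤ k)) (by norm_num)
    have h8 := h 8 (pow_dvd_pow 2 hk) (by norm_num)
    have := Nat.pow_le_pow_right (n := 2) (by norm_num) hk
    omega
  · right
    have h2 : 2 < p := hp.two_le.lt_of_ne (by rintro rfl; exact absurd ho (by decide))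
    have hpq : p = q := by
      refine (h p hpn h2).resolve_right ?_
      rintro rfl
      rcases (Nat.dvd_prime hp).1 hdvd with rfl | rfl <;> omega
    subst hpq
    refine ⟨p, hp, ho, ?_⟩
    obtain ⟨t, rfl⟩ := hdvd
    by_cases ht : 2 < t
    · rcases h t (dvd_mul_left t p) ht with rfl | ht'
      · left; ring
      · nlinarith
    · right
      have : t = 2 := by
        interval_cases t <;> omega
      rw [this, mul_comm]

lemma exists_zmod_hom {G : Type*} [Group G] {g : G} {n : ℕ} (hn : orderOf g = n) :
    ∃ f : Multiplicative (ZMod n) →* G,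
      Injective f ∧ f.range = zpowers g ∧ f (.ofAdd 1) = g := by
  let e := zmodMulEquivOfGenerator (g := (⟨g, mem_zpowers g⟩ : zpowers g))
    (fun ⟨_, k, hk⟩ ↦ ⟨k, Subtype.ext hk⟩) ((Nat.card_zpowers g).trans hn)
  refine ⟨(zpowers g).subtype.comp e.toMonoidHom,
    (Subtype.val_injective).comp e.injective, ?_, ?_⟩
  · rw [MonoidHom.range_comp]
    simp [← MonoidHom.range_eq_map]
  · simp [e]

variable {G : Type*} [Group G]

lemma nonempty_mulEquiv_of_mem_zpowers [Finite G] {a b : G} (hb : b ^ 2 ≠ 1)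
    (hne : zpowers a ≠ zpowers b)
    (h : ∀ x : G, x ^ 2 ≠ 1 → zpowers x = zpowers a ∨ zpowers x = zpowers b)
    (hba : b ∈ zpowers a) :
    ∃ n, (n = 8 ∨ ∃ p : ℕ, p.Prime ∧ Odd p ∧ (n = p ^ 2 ∨ n = 2 * p)) ∧
      (Nonempty (G ≃* Multiplicative (ZMod n)) ∨ Nonempty (G ≃* DihedralGroup n)) := by
  have hle : zpowers b ≤ zpowers a := by rwa [zpowers_le]
  have hdvd : orderOf b ∣ orderOf a := orderOf_dvd_of_mem_zpowers hba
  have hlt : orderOf b < orderOf a := by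
    refine (Nat.le_of_dvd (orderOf_pos a) hdvd).lt_of_ne fun heq ↦ hne ?_
    exact (Subgroup.eq_of_le_of_card_ge hle (by simp [Nat.card_zpowers, heq])).symm
  have hb2 := (sq_ne_one_iff b).1 hb
  refine ⟨orderOf a, eight_or_prime_sq_or_two_mul_prime hb2 hlt hdvd ?_, ?_⟩
  · rintro d ⟨k, hk⟩ hd
    have hd' : orderOf (a ^ k) = d := by
      have hk0 : k ≠ 0 := by rintro rfl; have := orderOf_pos a; omega
      rw [orderOf_pow_of_dvd hk0 (by rw [hk]; exact dvd_mul_left k d)]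
      exact Nat.div_eq_of_eq_mul_left (by omega) hk
    have := h (a ^ k) ((sq_ne_one_iff _).2 (hd' ▸ hd))
    rw [← hd', ← Nat.card_zpowers, ← Nat.card_zpowers b, ← Nat.card_zpowers a]
    rcases this with h | h <;> rw [h] <;> simp
  · obtain ⟨f, hfi, hfr, hf1⟩ := exists_zmod_hom (rfl : orderOf a = _)
    have hf : IsInvolutiveOutside f := by
      refine ⟨hfi, fun g hg ↦ ?_⟩
      by_contra hg2
      rw [hfr] at hg
      rcases h g hg2 with h | h
      · exact hg (h ▸ mem_zpowers g)
      · exact hg (hle (h ▸ mem_zpowers g))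
    refine hf.nonempty_mulEquiv_or (isInvolutiveOutside_rotation _) (c := .ofAdd 1) ?_
      (not_surjective_rotation _)
    intro hc
    have := congrArg f hc
    rw [map_pow, hf1, map_one] at this
    exact (sq_ne_one_iff a).2 (hb2.trans hlt) this

lemma mul_sq_eq_one {a b : G}
    (h : ∀ x : G, x ^ 2 ≠ 1 → zpowers x = zpowers a ∨ zpowers x = zpowers b)
    (hab : a ∉ zpowers b) (hba : b ∉ zpowers a) : (a * b) ^ 2 = 1 := by
  by_contra h2
  rcases h _ h2 with h | h
  · exact hba ((mul_mem_cancel_left (mem_zpowers a)).1 (h ▸ mem_zpowers (a * b)))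
  · exact hab ((mul_mem_cancel_right (mem_zpowers b)).1 (h ▸ mem_zpowers (a * b)))

lemma sq_eq_one_of_mem_of_mem {a b : G}
    (h : ∀ x : G, x ^ 2 ≠ 1 → zpowers x = zpowers a ∨ zpowers x = zpowers b)
    (hab : a ∉ zpowers b) (hba : b ∉ zpowers a)
    {z : G} (hza : z ∈ zpowers a) (hzb : z ∈ zpowers b) : z ^ 2 = 1 := by
  by_contra h2
  rcases h _ h2 with h | h
  · exact hab (zpowers_le.2 hzb (h ▸ mem_zpowers a))
  · exact hba (zpowers_le.2 hza (h ▸ mem_zpowers b))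

lemma conj_mem_zpowers {a b : G} (ha : a ^ 2 ≠ 1)
    (h : ∀ x : G, x ^ 2 ≠ 1 → zpowers x = zpowers a ∨ zpowers x = zpowers b)
    (hab : a ∉ zpowers b) : b * a * b⁻¹ ∈ zpowers a := by
  have h2 : (b * a * b⁻¹) ^ 2 ≠ 1 := by
    rw [conj_pow]
    simpa using ha
  rcases h _ h2 with h | h
  · exact h ▸ mem_zpowers _
  · refine (hab ?_).elim
    have : b * a * b⁻¹ ∈ zpowers b := h ▸ mem_zpowers _
    simpa [mul_assoc] using mul_mem (mul_mem (inv_mem (mem_zpowers b)) this) (mem_zpowers b)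

lemma commute_and_sq_eq_sq {a b : G} (ha : a ^ 2 ≠ 1) (hb : b ^ 2 ≠ 1)
    (h : ∀ x : G, x ^ 2 ≠ 1 → zpowers x = zpowers a ∨ zpowers x = zpowers b)
    (hab : a ∉ zpowers b) (hba : b ∉ zpowers a) :
    Commute a b ∧ a ^ 2 = b ^ 2 ∧ a ^ 4 = 1 := by
  have h1 := mul_sq_eq_one h hab hba
  have h2 : (a * b⁻¹) ^ 2 = 1 :=
    mul_sq_eq_one (by simpa using h) (by simpa using hab) (by simpa using hba)
  obtain ⟨z, hz⟩ : ∃ z, z = a * b * a⁻¹ * b⁻¹ := ⟨_, rfl⟩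
  have hza : z ∈ zpowers a := by
    have := mul_mem (mem_zpowers a) (inv_mem (conj_mem_zpowers ha h hab))
    simpa [hz, mul_assoc] using this
  have hzb : z ∈ zpowers b := by
    have := conj_mem_zpowers hb (fun x hx ↦ (h x hx).symm) hba
    exact hz ▸ mul_mem this (inv_mem (mem_zpowers b))
  have hz2 := sq_eq_one_of_mem_of_mem h hab hba hza hzb
  have hca : z * a = a * z := by
    obtain ⟨k, rfl⟩ := hza
    exact (Commute.refl a).zpow_left k
  have hcb : z * b = b * z := by
    obtain ⟨k, rfl⟩ := hzb
    exact (Commute.refl b).zpow_left k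
  have hba' : b * a = z * a * b := by
    rw [pow_two, mul_eq_one_iff_eq_inv] at hz2
    rw [hz2, hz]
    group
  have hba'' : b⁻¹ * a = z * a * b⁻¹ := by
    rw [eq_mul_inv_iff_mul_eq, mul_assoc, inv_mul_eq_iff_eq_mul, ← mul_assoc, ← hcb, mul_assoc z,
      hba', ← mul_assoc, ← mul_assoc, ← pow_two, hz2, one_mul]
  have h3 : z * a ^ 2 * b ^ 2 = 1 := by
    rw [← h1, pow_two, pow_two, pow_two, mul_assoc a b, ← mul_assoc b, hba', ← mul_assoc z, hca]
    simp only [mul_assoc]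
    rw [← mul_assoc z a, hca, mul_assoc]
  have h4 : z * a ^ 2 * (b ^ 2)⁻¹ = 1 := by
    rw [← h2, pow_two, pow_two, pow_two, mul_assoc a b⁻¹, ← mul_assoc b⁻¹, hba'', ← mul_assoc z,
      hca]
    simp only [mul_assoc, mul_inv_rev]
    rw [← mul_assoc z a, hca, mul_assoc]
  have hsq : z * a ^ 2 = b ^ 2 := by rwa [mul_inv_eq_one] at h4
  have hb4 : b ^ 2 * b ^ 2 = 1 := by rwa [hsq] at h3
  have hzc : Commute z (a ^ 2) := (show Commute z a from hca).pow_right 2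
  have ha4 : a ^ 4 = 1 := by
    rw [← hsq, ← pow_two, hzc.mul_pow, hz2, one_mul, ← pow_mul] at hb4
    exact hb4
  have hz1 : z = 1 := by
    by_contra hz1
    have hza2 : z = a ^ 2 := by
      have ha4' : a ^ (4 : ℤ) = 1 := mod_cast ha4
      obtain ⟨k, hk⟩ := hza
      simp only at hk
      obtain ⟨j, rfl | rfl⟩ := Int.even_or_odd' k
      · refine (eq_one_or_eq_of_mem_zpowers (by rwa [← pow_mul]) ⟨j, ?_⟩).resolve_left hz1
        rw [← hk, zpow_mul]
        norm_cast
      · refine (ha ?_).elim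
        rw [← hk, ← zpow_natCast, ← zpow_mul,
          show (2 * j + 1) * ((2 : ℕ) : ℤ) = 4 * j + (2 : ℕ) by push_cast; ring, zpow_add, zpow_mul,
          ha4', one_zpow, one_mul, zpow_natCast] at hz2
        exact hz2
    rw [← hza2, ← pow_two, hz2] at hsq
    exact hb hsq.symm
  rw [hz1, one_mul] at hsq hba'
  exact ⟨hba'.symm, hsq, ha4⟩

lemma exists_isInvolutiveOutside {a b : G} (ha : a ^ 2 ≠ 1)
    (h : ∀ x : G, x ^ 2 ≠ 1 → zpowers x = zpowers a ∨ zpowers x = zpowers b)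
    (hba : b ∉ zpowers a) (hc : Commute a b) (hsq : a ^ 2 = b ^ 2) (ha4 : a ^ 4 = 1) :
    ∃ f : Multiplicative (ZMod 2) × Multiplicative (ZMod 4) →* G, IsInvolutiveOutside f := by
  have hoa : orderOf a = 4 := orderOf_eq_prime_pow (p := 2) (n := 1) (by simpa using ha) ha4
  have hmem : a * b ∉ zpowers a := fun hm ↦
    hba ((mul_mem_cancel_left (mem_zpowers a)).1 hm)
  have hoab : orderOf (a * b) = 2 := by
    refine orderOf_eq_prime ?_ fun h1 ↦ hmem (h1 ▸ one_mem _)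
    rw [hc.mul_pow, ← hsq, ← pow_add, ha4]
  obtain ⟨f, hfi, hfr, hf1⟩ := exists_zmod_hom hoab
  obtain ⟨g, hgi, hgr, hg1⟩ := exists_zmod_hom hoa
  have hcomm : ∀ i j, Commute (f i) (g j) := fun i j ↦ by
    have hi : f i ∈ zpowers (a * b) := hfr ▸ ⟨i, rfl⟩
    have hj : g j ∈ zpowers a := hgr ▸ ⟨j, rfl⟩
    obtain ⟨k, hk⟩ := hi
    obtain ⟨l, hl⟩ := hj
    rw [← hk, ← hl]
    exact (((Commute.refl a).mul_left hc.symm).zpow_left k).zpow_right l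
  have hf : IsInvolutiveOutside (f.noncommCoprod g hcomm) := by
    constructor
    · rw [injective_iff_map_eq_one]
      rintro ⟨i, j⟩ hij
      rw [MonoidHom.noncommCoprod_apply] at hij
      have hj : g j ∈ zpowers a := hgr ▸ ⟨j, rfl⟩
      have hi : f i = 1 ∨ f i = a * b :=
        eq_one_or_eq_of_mem_zpowers (orderOf_dvd_iff_pow_eq_one.1 hoab.dvd) (hfr ▸ ⟨i, rfl⟩)
      rcases hi with hi | hi
      · rw [hi, one_mul] at hij
        exact Prod.ext (hfi (hi.trans (map_one f).symm)) (hgi (hij.trans (map_one g).symm))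
      · rw [hi, mul_eq_one_iff_eq_inv] at hij
        exact (hmem (hij ▸ inv_mem hj)).elim
    · intro x hx
      by_contra hx2
      have hra : a ∈ (f.noncommCoprod g hcomm).range := ⟨(1, .ofAdd 1), by simp [hg1]⟩
      have hrab : a * b ∈ (f.noncommCoprod g hcomm).range := ⟨(.ofAdd 1, 1), by simp [hf1]⟩
      have hrb : b ∈ (f.noncommCoprod g hcomm).range := by
        simpa using mul_mem (inv_mem hra) hrab
      rcases h x hx2 with h | h
      · exact hx (zpowers_le.2 hra (h ▸ mem_zpowers x))
      · exact hx (zpowers_le.2 hrb (h ▸ mem_zpowers x))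
  exact ⟨_, hf⟩

end BigCyc

open BigCyc in
theorem stmt_4 (G : Type*) [Group G] [Finite G] :
    numInv G = numCyc G - 2 ↔
      Nonempty (G ≃* Multiplicative (ZMod 2) × Multiplicative (ZMod 4)) ∨
      Nonempty (G ≃* Multiplicative (ZMod 2) × DihedralGroup 4) ∨
      Nonempty (G ≃* Multiplicative (ZMod 8)) ∨
      Nonempty (G ≃* DihedralGroup 8) ∨
      (∃ p : ℕ, p.Prime ∧ Odd p ∧ Nonempty (G ≃* Multiplicative (ZMod (p ^ 2)))) ∨
      (∃ p : ℕ, p.Prime ∧ Odd p ∧ Nonempty (G ≃* DihedralGroup (p ^ 2))) ∨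
      (∃ p : ℕ, p.Prime ∧ Odd p ∧ Nonempty (G ≃* Multiplicative (ZMod (2 * p)))) ∨
      (∃ p : ℕ, p.Prime ∧ Odd p ∧ Nonempty (G ≃* DihedralGroup (2 * p))) := by
  rw [numInv_eq_iff]
  constructor
  · rw [numBigCyc_eq_two_iff]
    rintro ⟨a, b, ha, hb, hne, h⟩
    by_cases hcomp : b ∈ Subgroup.zpowers a ∨ a ∈ Subgroup.zpowers b
    · obtain ⟨n, hn, hG⟩ : ∃ n, (n = 8 ∨ ∃ p : ℕ, p.Prime ∧ Odd p ∧ (n = p ^ 2 ∨ n = 2 * p)) ∧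
          (Nonempty (G ≃* Multiplicative (ZMod n)) ∨ Nonempty (G ≃* DihedralGroup n)) := by
        rcases hcomp with hba | hab
        · exact nonempty_mulEquiv_of_mem_zpowers hb hne h hba
        · exact nonempty_mulEquiv_of_mem_zpowers ha hne.symm (fun x hx ↦ (h x hx).symm) hab
      rcases hn with rfl | ⟨p, hp, ho, rfl | rfl⟩
      · tauto
      · rcases hG with hG | hG
        · exact .inr (.inr (.inr (.inr (.inl ⟨p, hp, ho, hG⟩))))
        · exact .inr (.inr (.inr (.inr (.inr (.inl ⟨p, hp, ho, hG⟩)))))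
      · rcases hG with hG | hG
        · exact .inr (.inr (.inr (.inr (.inr (.inr (.inl ⟨p, hp, ho, hG⟩))))))
        · exact .inr (.inr (.inr (.inr (.inr (.inr (.inr ⟨p, hp, ho, hG⟩))))))
    · obtain ⟨hba, hab⟩ := not_or.1 hcomp
      obtain ⟨hc, hsq, ha4⟩ := commute_and_sq_eq_sq ha hb h hab hba
      obtain ⟨f, hf⟩ := exists_isInvolutiveOutside ha h hba hc hsq ha4
      have := hf.nonempty_mulEquiv_or isInvolutiveOutside_prodMap_rotation
        (c := (1, .ofAdd 1)) (by decide) not_surjective_prodMap_rotation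
      tauto
  · rintro (⟨⟨e⟩⟩ | ⟨⟨e⟩⟩ | ⟨⟨e⟩⟩ | ⟨⟨e⟩⟩ | ⟨p, hp, ho, ⟨e⟩⟩ | ⟨p, hp, ho, ⟨e⟩⟩ |
      ⟨p, hp, ho, ⟨e⟩⟩ | ⟨p, hp, ho, ⟨e⟩⟩) <;>
    rw [e.symm.isInvolutiveOutside.numBigCyc_eq]
    · exact numBigCyc_zmod_two_prod_zmod_four
    · rw [isInvolutiveOutside_prodMap_rotation.numBigCyc_eq]
      exact numBigCyc_zmod_two_prod_zmod_four
    · exact numBigCyc_zmod_eight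
    · rw [(isInvolutiveOutside_rotation _).numBigCyc_eq, numBigCyc_zmod_eight]
    · exact numBigCyc_zmod_prime_sq hp ho
    · rw [(isInvolutiveOutside_rotation _).numBigCyc_eq, numBigCyc_zmod_prime_sq hp ho]
    · exact numBigCyc_zmod_two_mul_prime hp ho
    · rw [(isInvolutiveOutside_rotation _).numBigCyc_eq, numBigCyc_zmod_two_mul_prime hp ho]
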